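/- Let G, m, μ > 0 and let A(r) = 1 − (4Gm/(√π r)) ∫₀^{μ²r²/4} √t e^{-t} dt for r > 0 be the lapse of the non-local Schwarzschild-like solution. Then lim_{r→0⁺} ( A(r) − 1 ) / r² = − G m μ³ / (3√π); i.e., near the origin A(r) = 1 − (Gmμ³/(3√π)) r² + O(r⁴), so the metric possesses a regular de Sitter core with curvature set by the non-locality scale μ. -/

import Mathlib

open Real MeasureTheory Set Filter Topology

theorem integral_sqrt_zero_sq {s : ℝ} (hs : 0 ≤ s) :
    ∫ t in (0:ℝ)..s ^ 2, Real.sqrt t = 2 / 3 * s ^ 3 := by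
  simp_rw [Real.sqrt_eq_rpow]
  rw [integral_rpow (Or.inl (by norm_num)), Real.zero_rpow (by norm_num),
    ← Real.rpow_natCast s 2, ← Real.rpow_mul hs, ← Real.rpow_natCast s 3]
  norm_num
  ring

theorem integral_sqrt_mul_exp_neg_le {s : ℝ} (hs : 0 ≤ s) :
    ∫ t in (0:ℝ)..s ^ 2, Real.sqrt t * Real.exp (-t) ≤ 2 / 3 * s ^ 3 := by
  rw [← integral_sqrt_zero_sq hs]
  refine intervalIntegral.integral_mono_on (sq_nonneg s)
    (Continuous.intervalIntegrable (by fun_prop) _ _)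
    (Continuous.intervalIntegrable (by fun_prop) _ _) fun t ht => ?_
  exact mul_le_of_le_one_right (Real.sqrt_nonneg t) (Real.exp_le_one_iff.2 (by linarith [ht.1]))

theorem le_integral_sqrt_mul_exp_neg {s : ℝ} (hs : 0 ≤ s) :
    2 / 3 * s ^ 3 * Real.exp (-s ^ 2) ≤
      ∫ t in (0:ℝ)..s ^ 2, Real.sqrt t * Real.exp (-t) := by
  rw [← integral_sqrt_zero_sq hs, ← intervalIntegral.integral_mul_const]
  refine intervalIntegral.integral_mono_on (sq_nonneg s)
    (Continuous.intervalIntegrable (by fun_prop) _ _)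
    (Continuous.intervalIntegrable (by fun_prop) _ _) fun t ht => ?_
  exact mul_le_mul_of_nonneg_left (Real.exp_le_exp.2 (neg_le_neg ht.2)) (Real.sqrt_nonneg t)

theorem tendsto_integral_sqrt_mul_exp_neg_div :
    Tendsto (fun s : ℝ => (∫ t in (0:ℝ)..s ^ 2, Real.sqrt t * Real.exp (-t)) / s ^ 3)
      (𝓝[>] 0) (𝓝 (2 / 3)) := by
  have hlow : Tendsto (fun s : ℝ => 2 / 3 * Real.exp (-s ^ 2)) (𝓝[>] 0) (𝓝 (2 / 3)) := by
    have h : Continuous fun s : ℝ => 2 / 3 * Real.exp (-s ^ 2) := by fun_prop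
    simpa using (h.tendsto 0).mono_left nhdsWithin_le_nhds
  refine tendsto_of_tendsto_of_tendsto_of_le_of_le' hlow tendsto_const_nhds ?_ ?_
  · filter_upwards [self_mem_nhdsWithin] with s (hs : 0 < s)
    rw [le_div_iff₀ (by positivity)]
    linarith [le_integral_sqrt_mul_exp_neg hs.le]
  · filter_upwards [self_mem_nhdsWithin] with s (hs : 0 < s)
    rw [div_le_iff₀ (by positivity)]
    exact integral_sqrt_mul_exp_neg_le hs.le

/-- De Sitter core of the non-local Schwarzschild-like solution: the lapse
`A(r) = 1 − (4Gm/(√π r)) ∫₀^{μ²r²/4} √t e^{-t} dt` satisfies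
`(A(r) − 1)/r² → −Gmμ³/(3√π)` as `r → 0⁺`, i.e. near the origin
`A(r) = 1 − (Gmμ³/(3√π)) r² + O(r⁴)`. -/
theorem gaussian_lapse_de_sitter_core
    (G m μ : ℝ) (hG : 0 < G) (hm : 0 < m) (hμ : 0 < μ)
    (A : ℝ → ℝ)
    (hA : ∀ r : ℝ, 0 < r → A r = 1 - 4 * G * m / (Real.sqrt π * r) *
      ∫ t in (0:ℝ)..(μ ^ 2 * r ^ 2 / 4), Real.sqrt t * Real.exp (-t)) :
    Tendsto (fun r => (A r - 1) / r ^ 2) (nhdsWithin 0 (Ioi 0))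
      (nhds (-(G * m * μ ^ 3 / (3 * Real.sqrt π)))) := by
  have hscale : Tendsto (fun r : ℝ => μ * r / 2) (𝓝[>] 0) (𝓝[>] 0) := by
    refine tendsto_nhdsWithin_iff.2 ⟨?_, ?_⟩
    · have h : Continuous fun r : ℝ => μ * r / 2 := by fun_prop
      simpa using (h.tendsto 0).mono_left nhdsWithin_le_nhds
    · filter_upwards [self_mem_nhdsWithin] with r (hr : 0 < r)
      exact mem_Ioi.2 (by positivity)
  have hπ : Real.sqrt π ≠ 0 := (Real.sqrt_pos.2 Real.pi_pos).ne'
  have hlim := (tendsto_integral_sqrt_mul_exp_neg_div.comp hscale).const_mul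
    (-(G * m * μ ^ 3 / (2 * Real.sqrt π)))
  have hval : -(G * m * μ ^ 3 / (2 * Real.sqrt π)) * (2 / 3) =
      -(G * m * μ ^ 3 / (3 * Real.sqrt π)) := by
    field_simp
  rw [hval] at hlim
  refine hlim.congr' ?_
  filter_upwards [self_mem_nhdsWithin] with r (hr : 0 < r)
  have hsq : (μ * r / 2) ^ 2 = μ ^ 2 * r ^ 2 / 4 := by ring
  simp only [Function.comp_apply, hA r hr, hsq]
  field_simp
  ring
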